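/- Let 0 < p < 1 and 0 < q < 1. For every ε > 0 there exists a measurable function f : {0,1}^ℕ → {0,1}^ℕ such that, when X ~ Bernoulli(p)^ℕ and Y ~ Bernoulli(q)^ℕ are independent: (i) f(X) ~ Bernoulli(1/2)^ℕ; and (ii) E[ d_TV( L(f(X) | max(X,Y)), Bernoulli(1/2)^ℕ ) ] < ε, where L(f(X) | max(X,Y)) is a regular conditional distribution of f(X) given max(X,Y) and d_TV(μ,ν) = sup over measurable sets A of |μ(A) − ν(A)|. -/

import Mathlib

open MeasureTheory ProbabilityTheory

/-- The Bernoulli measure on `Bool` assigning mass `r` to `true`. -/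
noncomputable def bernoulliMeasure (r : ℝ) : Measure Bool :=
  ENNReal.ofReal r • Measure.dirac true + ENNReal.ofReal (1 - r) • Measure.dirac false

/-- `μ` is the product of Bernoulli(`r`) measures over the index set `I`:
it is a probability measure whose finite-dimensional marginals are i.i.d. Bernoulli(`r`). -/
def IsBernoulliProduct {I : Type*} (r : ℝ) (μ : Measure (I → Bool)) : Prop :=
  IsProbabilityMeasure μ ∧
    ∀ (s : Finset I) (b : I → Bool),
      μ {x | ∀ i ∈ s, x i = b i} =
        ∏ i ∈ s, (if b i then ENNReal.ofReal r else ENNReal.ofReal (1 - r))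

/-! ### Bias of a measure on `Bool` -/

/-- The sign `-1` of `true` and `1` of `false`. -/
def boolSign (b : Bool) : ℝ := if b then -1 else 1

/-- The expected sign under a measure on `Bool`. -/
noncomputable def boolBias (m : Measure Bool) : ℝ := ∫ b, boolSign b ∂m

lemma abs_boolSign (b : Bool) : |boolSign b| = 1 := by cases b <;> simp [boolSign]

lemma boolSign_decide_neg {v : ℝ} (hv : |v| = 1) : boolSign (decide (v < 0)) = v := by
  rcases eq_or_eq_neg_of_abs_eq hv with rfl | rfl <;> norm_num [boolSign]

lemma boolBias_map {Ω : Type*} [MeasurableSpace Ω] (μ : Measure Ω) {g : Ω → Bool}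
    (hg : Measurable g) : boolBias (μ.map g) = ∫ x, boolSign (g x) ∂μ :=
  integral_map hg.aemeasurable (measurable_of_countable _).aestronglyMeasurable

lemma abs_integral_boolSign_le {Ω : Type*} [MeasurableSpace Ω] (μ : Measure Ω)
    [IsProbabilityMeasure μ] (g : Ω → Bool) : |∫ x, boolSign (g x) ∂μ| ≤ 1 := by
  simpa using norm_integral_le_of_norm_le_const (μ := μ) (f := fun x ↦ boolSign (g x)) (C := 1)
    (.of_forall fun x ↦ (abs_boolSign _).le)

lemma bernoulliMeasure_true (r : ℝ) : _root_.bernoulliMeasure r {true} = ENNReal.ofReal r := by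
  simp [_root_.bernoulliMeasure]

lemma bernoulliMeasure_false (r : ℝ) :
    _root_.bernoulliMeasure r {false} = ENNReal.ofReal (1 - r) := by
  simp [_root_.bernoulliMeasure]

lemma bernoulliMeasure_singleton (r : ℝ) (b : Bool) :
    _root_.bernoulliMeasure r {b} = if b then ENNReal.ofReal r else ENNReal.ofReal (1 - r) := by
  cases b <;> simp [_root_.bernoulliMeasure]

lemma isProbabilityMeasure_bernoulliMeasure {r : ℝ} (h0 : 0 ≤ r) (h1 : r ≤ 1) :
    IsProbabilityMeasure (_root_.bernoulliMeasure r) := by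
  constructor
  simp [_root_.bernoulliMeasure, ← ENNReal.ofReal_add h0 (sub_nonneg.2 h1)]

instance : IsProbabilityMeasure (_root_.bernoulliMeasure (1 / 2)) :=
  isProbabilityMeasure_bernoulliMeasure (by norm_num) (by norm_num)

lemma boolBias_bernoulliMeasure {r : ℝ} (h0 : 0 ≤ r) (h1 : r ≤ 1) :
    boolBias (_root_.bernoulliMeasure r) = 1 - 2 * r := by
  have := isProbabilityMeasure_bernoulliMeasure h0 h1
  rw [boolBias, integral_fintype .of_finite]
  simp only [Fintype.sum_bool, measureReal_def, bernoulliMeasure_true, bernoulliMeasure_false,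
    ENNReal.toReal_ofReal h0, ENNReal.toReal_ofReal (sub_nonneg.2 h1)]
  simp [boolSign]
  ring

lemma eq_bernoulliMeasure (m : Measure Bool) [IsProbabilityMeasure m] :
    m = _root_.bernoulliMeasure ((1 - boolBias m) / 2) := by
  have hsum : m.real {true} + m.real {false} = 1 := by
    have h := probReal_add_probReal_compl (μ := m) (s := {true}) (measurableSet_singleton _)
    rwa [show ({true}ᶜ : Set Bool) = {false} by ext b; cases b <;> simp] at h
  have hb : boolBias m = m.real {false} - m.real {true} := by
    rw [boolBias, integral_fintype .of_finite]
    simp [boolSign]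
    ring
  refine Measure.ext_of_singleton fun b ↦ ?_
  rw [← ofReal_measureReal (measure_ne_top m _), bernoulliMeasure_singleton]
  cases b
  · simp only [Bool.false_eq_true, if_false]
    congr 1
    linarith
  · simp only [if_true]
    congr 1
    linarith

lemma abs_boolBias_le_one (m : Measure Bool) [IsProbabilityMeasure m] : |boolBias m| ≤ 1 :=
  abs_integral_boolSign_le m id

/-! ### Product measures on sequences over a finite alphabet -/

lemma eq_infinitePi_of_forall_cylinder {I α : Type*} [Finite α] [MeasurableSpace α]
    [MeasurableSingletonClass α] {μ : Measure (I → α)} {m : I → Measure α}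
    [∀ i, IsProbabilityMeasure (m i)]
    (h : ∀ (s : Finset I) (b : I → α), μ {x | ∀ i ∈ s, x i = b i} = ∏ i ∈ s, m i {b i}) :
    μ = Measure.infinitePi m := by
  rcases isEmpty_or_nonempty α with hα | ⟨⟨a⟩⟩
  · rcases isEmpty_or_nonempty I with hI | ⟨⟨i⟩⟩
    · refine Measure.eq_infinitePi _ fun s t _ ↦ ?_
      have := h ∅ (fun i ↦ hI.elim i)
      simp_all [Finset.eq_empty_of_isEmpty]
    · exact absurd (measure_univ (μ := m i)) (by simp [Set.eq_empty_of_isEmpty])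
  classical
  refine ((Measure.isProjectiveLimit_infinitePi m).unique fun s ↦ ?_).symm
  refine Measure.ext_of_singleton fun b ↦ ?_
  let c : I → α := fun i ↦ if hi : i ∈ s then b ⟨i, hi⟩ else a
  have hc : ∀ i : s, c i = b i := fun i ↦ by simp [c]
  rw [Measure.map_apply (by fun_prop) (measurableSet_singleton b), Measure.pi_singleton]
  have : s.restrict ⁻¹' ({b} : Set (s → α)) = {x : I → α | ∀ i ∈ s, x i = c i} := by
    ext x
    simp only [Set.mem_preimage, Set.mem_singleton_iff, funext_iff, Set.mem_ofPred_eq,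
      Finset.restrict, ← hc, Subtype.forall]
  rw [this, h s c, ← Finset.prod_coe_sort]
  simp only [hc]

lemma infinitePi_cylinder_eq {I α : Type*} [MeasurableSpace α]
    [MeasurableSingletonClass α] {m : I → Measure α} [∀ i, IsProbabilityMeasure (m i)]
    (s : Finset I) (b : I → α) :
    Measure.infinitePi m {x | ∀ i ∈ s, x i = b i} = ∏ i ∈ s, m i {b i} := by
  rw [← Measure.infinitePi_pi m fun i _ ↦ measurableSet_singleton (b i)]
  congr 1

lemma IsBernoulliProduct.eq_infinitePi {I : Type*} {r : ℝ} {μ : Measure (I → Bool)}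
    (h0 : 0 ≤ r) (h1 : r ≤ 1) (h : IsBernoulliProduct r μ) :
    μ = Measure.infinitePi fun _ ↦ _root_.bernoulliMeasure r := by
  have := isProbabilityMeasure_bernoulliMeasure h0 h1
  refine eq_infinitePi_of_forall_cylinder fun s b ↦ ?_
  simpa only [bernoulliMeasure_singleton] using h.2 s b

lemma isBernoulliProduct_infinitePi {I : Type*} {r : ℝ} (h0 : 0 ≤ r) (h1 : r ≤ 1) :
    IsBernoulliProduct r (Measure.infinitePi fun _ : I ↦ _root_.bernoulliMeasure r) := by
  have := isProbabilityMeasure_bernoulliMeasure h0 h1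
  refine ⟨inferInstance, fun s b ↦ ?_⟩
  simp only [infinitePi_cylinder_eq, bernoulliMeasure_singleton]

/-- Zipping two independent sequences of independent variables. -/
lemma map_zip_infinitePi_prod {I α β : Type*} [Countable I] [Finite α] [Finite β]
    [MeasurableSpace α] [MeasurableSpace β] [MeasurableSingletonClass α]
    [MeasurableSingletonClass β] (m : I → Measure α) (n : I → Measure β)
    [∀ i, IsProbabilityMeasure (m i)] [∀ i, IsProbabilityMeasure (n i)] :
    ((Measure.infinitePi m).prod (Measure.infinitePi n)).map (fun ω i ↦ (ω.1 i, ω.2 i)) =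
      Measure.infinitePi fun i ↦ (m i).prod (n i) := by
  refine eq_infinitePi_of_forall_cylinder fun s b ↦ ?_
  have hs : MeasurableSet {x : I → α × β | ∀ i ∈ s, x i = b i} := by
    have : {x : I → α × β | ∀ i ∈ s, x i = b i} = (s : Set I).pi fun i ↦ {b i} := by
      ext; simp [Set.mem_pi]
    rw [this]
    exact .pi s.countable_toSet fun i _ ↦ measurableSet_singleton _
  have : (fun (ω : (I → α) × (I → β)) i ↦ (ω.1 i, ω.2 i)) ⁻¹' {x | ∀ i ∈ s, x i = b i} =
      {x | ∀ i ∈ s, x i = (b i).1} ×ˢ {y | ∀ i ∈ s, y i = (b i).2} := by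
    ext ω
    simp [Prod.ext_iff, forall_and]
  rw [Measure.map_apply (by fun_prop) hs, this, Measure.prod_prod,
    infinitePi_cylinder_eq s fun i ↦ (b i).1, infinitePi_cylinder_eq s fun i ↦ (b i).2,
    ← Finset.prod_mul_distrib]
  refine Finset.prod_congr rfl fun i _ ↦ ?_
  rw [← Measure.prod_prod, Set.singleton_prod_singleton]

/-! ### Total variation distance to the fair product measure -/

lemma exists_coupling_bernoulliMeasure {r : ℝ} (h0 : 0 ≤ r) (h1 : r ≤ 1) :
    ∃ c : Measure (Bool × Bool), c.map Prod.fst = _root_.bernoulliMeasure r ∧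
      c.map Prod.snd = _root_.bernoulliMeasure (1 / 2) ∧
      c {x | x.1 ≠ x.2} ≤ ENNReal.ofReal |r - 1 / 2| := by
  rcases le_total r (1 / 2) with h | h
  · refine ⟨ENNReal.ofReal r • Measure.dirac (true, true) +
      ENNReal.ofReal (1 / 2) • Measure.dirac (false, false) +
      ENNReal.ofReal (1 / 2 - r) • Measure.dirac (false, true), ?_, ?_, ?_⟩
    · refine Measure.ext_of_singleton fun b ↦ ?_
      rw [Measure.map_apply measurable_fst (measurableSet_singleton b)]
      cases b
      · simp [-one_div, _root_.bernoulliMeasure]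
        rw [← ENNReal.ofReal_add (by norm_num) (by linarith)]
        ring_nf
      · simp [-one_div, _root_.bernoulliMeasure]
    · refine Measure.ext_of_singleton fun b ↦ ?_
      rw [Measure.map_apply measurable_snd (measurableSet_singleton b)]
      cases b
      · simp [-one_div, _root_.bernoulliMeasure]
        norm_num
      · simp [-one_div, _root_.bernoulliMeasure]
        rw [← ENNReal.ofReal_add h0 (by linarith)]
        ring_nf
    · rw [abs_of_nonpos (by linarith)]
      simp [-one_div]
  · refine ⟨ENNReal.ofReal (1 / 2) • Measure.dirac (true, true) +
      ENNReal.ofReal (1 - r) • Measure.dirac (false, false) +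
      ENNReal.ofReal (r - 1 / 2) • Measure.dirac (true, false), ?_, ?_, ?_⟩
    · refine Measure.ext_of_singleton fun b ↦ ?_
      rw [Measure.map_apply measurable_fst (measurableSet_singleton b)]
      cases b
      · simp [-one_div, _root_.bernoulliMeasure]
      · simp [-one_div, _root_.bernoulliMeasure]
        rw [← ENNReal.ofReal_add (by norm_num) (by linarith)]
        ring_nf
    · refine Measure.ext_of_singleton fun b ↦ ?_
      rw [Measure.map_apply measurable_snd (measurableSet_singleton b)]
      cases b
      · simp [-one_div, _root_.bernoulliMeasure]
        rw [← ENNReal.ofReal_add (by linarith) (by linarith)]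
        ring_nf
      · simp [-one_div, _root_.bernoulliMeasure]
    · rw [abs_of_nonneg (by linarith)]
      simp [-one_div]

/-- If `f` and `g` agree off a set, their laws differ by at most its measure. -/
lemma abs_measure_preimage_sub_le {Ω E : Type*} [MeasurableSpace Ω] (Q : Measure Ω)
    [IsFiniteMeasure Q] (f g : Ω → E) (A : Set E) :
    ENNReal.ofReal |(Q (f ⁻¹' A)).toReal - (Q (g ⁻¹' A)).toReal| ≤ Q {x | f x ≠ g x} := by
  have key (f g : Ω → E) :
      Q.real (f ⁻¹' A) ≤ Q.real (g ⁻¹' A) + Q.real {x | f x ≠ g x} := by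
    refine (measureReal_mono fun x hx ↦ ?_).trans (measureReal_union_le _ _)
    by_cases hfg : f x = g x
    · exact Or.inl (by simpa [← hfg] using hx)
    · exact Or.inr hfg
  refine ENNReal.ofReal_le_of_le_toReal (abs_sub_le_iff.2 ⟨?_, ?_⟩)
  · exact sub_le_iff_le_add'.2 (key f g)
  · have := key g f
    simp only [ne_comm (a := g _)] at this
    exact sub_le_iff_le_add'.2 this

lemma abs_infinitePi_sub_fair_le {I : Type*} [Countable I] (m : I → Measure Bool)
    [∀ i, IsProbabilityMeasure (m i)] {A : Set (I → Bool)} (hA : MeasurableSet A) :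
    ENNReal.ofReal |(Measure.infinitePi m A).toReal -
        (Measure.infinitePi (fun _ : I ↦ _root_.bernoulliMeasure (1 / 2)) A).toReal| ≤
      ∑' i, ENNReal.ofReal |boolBias (m i)| := by
  have hr i : 0 ≤ (1 - boolBias (m i)) / 2 ∧ (1 - boolBias (m i)) / 2 ≤ 1 := by
    have := abs_le.1 (abs_boolBias_le_one (m i))
    constructor <;> linarith
  choose c hc1 hc2 hc3 using fun i ↦ exists_coupling_bernoulliMeasure (hr i).1 (hr i).2
  have hc (i) : IsProbabilityMeasure (c i) := by
    have : IsProbabilityMeasure ((c i).map Prod.snd) := by rw [hc2]; infer_instance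
    exact Measure.isProbabilityMeasure_of_map Prod.snd
  set Q := Measure.infinitePi c
  have h1 : Q.map (fun x i ↦ (x i).1) = Measure.infinitePi m := by
    rw [Measure.infinitePi_map_pi c fun _ ↦ measurable_fst]
    congr! 2 with i
    rw [hc1, ← eq_bernoulliMeasure]
  have h2 : Q.map (fun x i ↦ (x i).2) =
      Measure.infinitePi fun _ ↦ _root_.bernoulliMeasure (1 / 2) := by
    rw [Measure.infinitePi_map_pi c fun _ ↦ measurable_snd]
    congr! 2 with i
    rw [hc2]
  have hne : Q {x | (fun i ↦ (x i).1) ≠ fun i ↦ (x i).2} ≤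
      ∑' i, ENNReal.ofReal |boolBias (m i)| := by
    have : {x : I → Bool × Bool | (fun i ↦ (x i).1) ≠ fun i ↦ (x i).2} =
        ⋃ i, Function.eval i ⁻¹' {x : Bool × Bool | x.1 ≠ x.2} := by
      ext x
      simp [funext_iff]
    rw [this]
    refine (measure_iUnion_le _).trans (ENNReal.tsum_le_tsum fun i ↦ ?_)
    rw [(measurePreserving_eval_infinitePi c i).measure_preimage
      (Set.toFinite _).measurableSet.nullMeasurableSet]
    refine (hc3 i).trans (ENNReal.ofReal_le_ofReal ?_)
    rw [show (1 - boolBias (m i)) / 2 - 1 / 2 = -(boolBias (m i) / 2) by ring, abs_neg, abs_div]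
    have := abs_nonneg (boolBias (m i))
    norm_num
  refine le_trans ?_ hne
  rw [← h1, ← h2, Measure.map_apply (by fun_prop) hA, Measure.map_apply (by fun_prop) hA]
  exact abs_measure_preimage_sub_le Q _ _ A

/-! ### The extractor -/

/-- The comparison bit of two sequences: `-1` iff the first one has smaller real code. -/
noncomputable def compareSign (x y : ℕ → Bool) : ℝ :=
  boolSign (decide (embeddingReal (ℕ → Bool) x < embeddingReal (ℕ → Bool) y))

/-- The parity of `n` bits of the first sequence, flipped by the comparison bit of the
other two sequences. -/
noncomputable def extractBit (n : ℕ) (u : Fin 3 × ℕ → Bool) : Bool :=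
  decide ((∏ j ∈ Finset.range n, boolSign (u (0, j))) *
    compareSign (fun j ↦ u (1, j)) (fun j ↦ u (2, j)) < 0)

lemma measurable_boolSign : Measurable boolSign := measurable_of_countable _

@[fun_prop]
lemma measurable_compareSign :
    Measurable fun x : (ℕ → Bool) × (ℕ → Bool) ↦ compareSign x.1 x.2 := by
  have := measurable_embeddingReal (ℕ → Bool)
  exact measurable_boolSign.comp
    (measurable_to_bool (by
      simpa [Set.preimage] using
        measurableSet_lt (this.comp measurable_fst) (this.comp measurable_snd)))

lemma abs_compareSign (x y : ℕ → Bool) : |compareSign x y| = 1 := abs_boolSign _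

lemma boolSign_extractBit (n : ℕ) (u : Fin 3 × ℕ → Bool) :
    boolSign (extractBit n u) = (∏ j ∈ Finset.range n, boolSign (u (0, j))) *
      compareSign (fun j ↦ u (1, j)) (fun j ↦ u (2, j)) :=
  boolSign_decide_neg (by simp [abs_mul, Finset.abs_prod, abs_boolSign, abs_compareSign])

@[fun_prop]
lemma measurable_extractBit (n : ℕ) : Measurable (extractBit n) := by
  have hs := measurable_boolSign
  have h : Measurable fun u : Fin 3 × ℕ → Bool ↦ (∏ j ∈ Finset.range n, boolSign (u (0, j))) *
      compareSign (fun j ↦ u (1, j)) (fun j ↦ u (2, j)) :=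
    .mul (Finset.measurable_fun_prod _ fun j _ ↦ by fun_prop)
      (measurable_compareSign.comp (f := fun u : Fin 3 × ℕ → Bool ↦
        (fun j ↦ u (1, j), fun j ↦ u (2, j))) (by fun_prop))
  refine measurable_to_bool ?_
  simpa [Set.preimage, extractBit] using measurableSet_lt h (measurable_const (a := (0 : ℝ)))

lemma iIndepFun_rows {I J α : Type*} [Countable I] [Countable J] [MeasurableSpace α]
    (m : I × J → Measure α) [∀ a, IsProbabilityMeasure (m a)] :
    iIndepFun (fun i (u : I × J → α) j ↦ u (i, j)) (Measure.infinitePi m) := by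
  rw [iIndepFun_iff_map_fun_eq_infinitePi_map (by fun_prop)]
  refine (Measure.infinitePi_map_curry fun i j ↦ m (i, j)).trans ?_
  congr! 2 with i
  exact (Measure.map_infinitePi_infinitePi_of_inj (f := fun j ↦ (i, j))
    fun _ _ h ↦ (Prod.ext_iff.1 h).2).symm

lemma integral_prod_boolSign {J : Type*} (m : J → Measure Bool) [∀ a, IsProbabilityMeasure (m a)]
    (s : Finset J) :
    ∫ u, ∏ j ∈ s, boolSign (u j) ∂Measure.infinitePi m = ∏ j ∈ s, boolBias (m j) := by
  have h := (iIndepFun_infinitePi (P := m) (X := fun _ ↦ boolSign)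
    fun _ ↦ measurable_boolSign).precomp (g := ((↑) : s → J)) Subtype.val_injective
  have := h.integral_fun_prod_eq_prod_integral fun j ↦
    (measurable_boolSign.comp (measurable_pi_apply _)).aestronglyMeasurable
  refine (integral_congr_ae (.of_forall fun u : J → Bool ↦
    (Finset.prod_coe_sort s fun j ↦ boolSign (u j)).symm)).trans (this.trans ?_)
  rw [Finset.prod_coe_sort s fun j ↦ ∫ u, boolSign (u j) ∂Measure.infinitePi m]
  refine Finset.prod_congr rfl fun j _ ↦ ?_
  rw [← boolBias_map _ (by fun_prop), Measure.infinitePi_map_eval]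

lemma boolBias_map_extractBit (n : ℕ) (m : Fin 3 × ℕ → Measure Bool)
    [∀ a, IsProbabilityMeasure (m a)] :
    boolBias ((Measure.infinitePi m).map (extractBit n)) =
      (∏ j ∈ Finset.range n, boolBias (m (0, j))) *
        ∫ u, compareSign (fun j ↦ u (1, j)) (fun j ↦ u (2, j)) ∂Measure.infinitePi m := by
  have hs := measurable_boolSign
  rw [boolBias_map _ (by fun_prop)]
  simp_rw [boolSign_extractBit]
  have hind := ((iIndepFun_rows m).indepFun_prodMk (by fun_prop) 1 2 0 (by decide) (by decide)).symm
  have hprod : Measurable fun x : ℕ → Bool ↦ ∏ j ∈ Finset.range n, boolSign (x j) :=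
    Finset.measurable_fun_prod _ fun j _ ↦ by fun_prop
  have := (hind.comp hprod measurable_compareSign).integral_fun_mul_eq_mul_integral
    (hprod.comp (measurable_pi_lambda _ fun _ ↦ by fun_prop)).aestronglyMeasurable
    (measurable_compareSign.comp (by fun_prop)).aestronglyMeasurable
  refine this.trans ?_
  congr 1
  have h0 := integral_prod_boolSign m ((Finset.range n).map
    ⟨fun j ↦ ((0 : Fin 3), j), fun _ _ h ↦ (Prod.ext_iff.1 h).2⟩)
  simp only [Finset.prod_map] at h0
  exact h0

lemma abs_boolBias_map_extractBit_le (n : ℕ) (m : Fin 3 × ℕ → Measure Bool)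
    [∀ a, IsProbabilityMeasure (m a)] :
    |boolBias ((Measure.infinitePi m).map (extractBit n))| ≤
      ∏ j ∈ Finset.range n, |boolBias (m (0, j))| := by
  rw [boolBias_map_extractBit, abs_mul, Finset.abs_prod]
  exact mul_le_of_le_one_right (Finset.prod_nonneg fun _ _ ↦ abs_nonneg _)
    (abs_integral_boolSign_le _ _)

lemma infinitePi_bernoulliMeasure_singleton {p : ℝ} (hp : 0 < p) (hp1 : p < 1) (x : ℕ → Bool) :
    Measure.infinitePi (fun _ : ℕ ↦ _root_.bernoulliMeasure p) {x} = 0 := by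
  have := isProbabilityMeasure_bernoulliMeasure hp.le hp1.le
  set r := max p (1 - p)
  have hr : r < 1 := max_lt hp1 (by linarith)
  refine le_antisymm (ge_of_tendsto' (ENNReal.tendsto_pow_atTop_nhds_zero_of_lt_one
    (ENNReal.ofReal_lt_one.2 hr)) fun n ↦ ?_) bot_le
  calc _ ≤ Measure.infinitePi (fun _ : ℕ ↦ _root_.bernoulliMeasure p)
        {y | ∀ i ∈ Finset.range n, y i = x i} := measure_mono (by simp +contextual)
    _ = ∏ i ∈ Finset.range n, _root_.bernoulliMeasure p {x i} := infinitePi_cylinder_eq _ _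
    _ ≤ ∏ i ∈ Finset.range n, ENNReal.ofReal r := by
        refine Finset.prod_le_prod' fun i _ ↦ ?_
        rw [bernoulliMeasure_singleton]
        split_ifs
        · exact ENNReal.ofReal_le_ofReal (le_max_left _ _)
        · exact ENNReal.ofReal_le_ofReal (le_max_right _ _)
    _ = _ := by simp

lemma integral_compareSign_prod_self (μ : Measure (ℕ → Bool)) [IsProbabilityMeasure μ]
    (hμ : ∀ x, μ {x} = 0) : ∫ ω, compareSign ω.1 ω.2 ∂μ.prod μ = 0 := by
  have hne : ∀ᵐ ω ∂μ.prod μ, ω.1 ≠ ω.2 := by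
    rw [Measure.ae_prod_iff_ae_ae]
    · refine .of_forall fun x ↦ ?_
      rw [ae_iff]
      convert hμ x using 2
      ext y
      simp [eq_comm]
    · exact (measurableSet_eq_fun measurable_fst measurable_snd).compl
  have hswap : ∫ ω, compareSign ω.2 ω.1 ∂μ.prod μ = ∫ ω, compareSign ω.1 ω.2 ∂μ.prod μ :=
    integral_prod_swap fun ω : (ℕ → Bool) × (ℕ → Bool) ↦ compareSign ω.1 ω.2
  have hneg : ∫ ω, compareSign ω.2 ω.1 ∂μ.prod μ = -∫ ω, compareSign ω.1 ω.2 ∂μ.prod μ := by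
    rw [← integral_neg]
    refine integral_congr_ae ?_
    filter_upwards [hne] with ω hω
    have := (measurableEmbedding_embeddingReal (ℕ → Bool)).injective.ne hω
    rcases this.lt_or_gt with h | h <;> simp [compareSign, boolSign, h, h.not_gt]
  linarith

lemma boolBias_map_extractBit_bernoulliMeasure (n : ℕ) {p : ℝ} (hp : 0 < p) (hp1 : p < 1) :
    boolBias ((Measure.infinitePi fun _ : Fin 3 × ℕ ↦ _root_.bernoulliMeasure p).map
      (extractBit n)) = 0 := by
  have := isProbabilityMeasure_bernoulliMeasure hp.le hp1.le
  have hrow (i : Fin 3) : (Measure.infinitePi fun _ : Fin 3 × ℕ ↦ _root_.bernoulliMeasure p).map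
      (fun u j ↦ u (i, j)) = Measure.infinitePi fun _ : ℕ ↦ _root_.bernoulliMeasure p :=
    Measure.map_infinitePi_infinitePi_of_inj (f := fun j ↦ (i, j))
      fun _ _ h ↦ (Prod.ext_iff.1 h).2
  have hind := (iIndepFun_rows fun _ : Fin 3 × ℕ ↦ _root_.bernoulliMeasure p).indepFun
    (show (1 : Fin 3) ≠ 2 by decide)
  have hlaw := (indepFun_iff_map_prod_eq_prod_map_map (Measurable.aemeasurable (by fun_prop))
    (Measurable.aemeasurable (by fun_prop))).1 hind
  rw [hrow, hrow] at hlaw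
  rw [boolBias_map_extractBit, ← integral_map (f := fun ω : (ℕ → Bool) × (ℕ → Bool) ↦
    compareSign ω.1 ω.2) (φ := fun u : Fin 3 × ℕ → Bool ↦ (fun j ↦ u (1, j), fun j ↦ u (2, j)))
    (by fun_prop) measurable_compareSign.aestronglyMeasurable, hlaw,
    integral_compareSign_prod_self _ (infinitePi_bernoulliMeasure_singleton hp hp1), mul_zero]

/-- An enumeration of the positions of a sequence as positions in countably many blocks of three
sequences. -/
noncomputable def blockEquiv : ℕ × (Fin 3 × ℕ) ≃ ℕ :=
  (nonempty_equiv_of_countable (α := ℕ × (Fin 3 × ℕ)) (β := ℕ)).some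

/-- The extractor whose `k`-th output bit is computed from the `k`-th block, using a parity of
`N + k` bits. -/
noncomputable def extractor (N : ℕ) (x : ℕ → Bool) (k : ℕ) : Bool :=
  extractBit (N + k) fun a ↦ x (blockEquiv (k, a))

@[fun_prop]
lemma measurable_extractor (N : ℕ) : Measurable (extractor N) := by
  unfold extractor
  fun_prop

lemma map_extractor_infinitePi (N : ℕ) (m : ℕ → Measure Bool) [∀ i, IsProbabilityMeasure (m i)] :
    (Measure.infinitePi m).map (extractor N) = Measure.infinitePi fun k ↦
      (Measure.infinitePi fun a ↦ m (blockEquiv (k, a))).map (extractBit (N + k)) := by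
  rw [← Measure.infinitePi_map_pi _ fun k ↦ measurable_extractBit (N + k),
    ← Measure.infinitePi_map_curry fun k a ↦ m (blockEquiv (k, a)),
    ← Measure.map_infinitePi_infinitePi_of_inj (P := m) blockEquiv.injective,
    Measure.map_map (by fun_prop) (by fun_prop), Measure.map_map (by fun_prop) (by fun_prop)]
  rfl

/-! ### Conditioning on the maximum -/

/-- Coordinatewise maximum of binary sequences. -/
def seqMax (ω : (ℕ → Bool) × (ℕ → Bool)) (i : ℕ) : Bool := max (ω.1 i) (ω.2 i)

@[fun_prop]
lemma measurable_seqMax : Measurable seqMax := by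
  have : Measurable fun x : Bool × Bool ↦ max x.1 x.2 := measurable_of_countable _
  exact measurable_pi_lambda _ fun i ↦
    this.comp (g := fun x : Bool × Bool ↦ max x.1 x.2)
      (f := fun ω : (ℕ → Bool) × (ℕ → Bool) ↦ (ω.1 i, ω.2 i)) (by fun_prop)

/-- Coordinatewise minimum of binary sequences. -/
def seqAnd (w z : ℕ → Bool) (i : ℕ) : Bool := w i && z i

@[fun_prop]
lemma measurable_seqAnd : Measurable fun x : (ℕ → Bool) × (ℕ → Bool) ↦ seqAnd x.1 x.2 := by
  have : Measurable fun x : Bool × Bool ↦ (x.1 && x.2) := measurable_of_countable _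
  exact measurable_pi_lambda _ fun i ↦
    this.comp (g := fun x : Bool × Bool ↦ (x.1 && x.2))
      (f := fun ω : (ℕ → Bool) × (ℕ → Bool) ↦ (ω.1 i, ω.2 i)) (by fun_prop)

lemma map_bernoulliMeasure_prod_max {p q s t : ℝ} (hp : 0 ≤ p) (hp1 : p ≤ 1) (hq : 0 ≤ q)
    (hq1 : q ≤ 1) (hs : 0 ≤ s) (hs1 : s ≤ 1) (ht : 0 ≤ t) (ht1 : t ≤ 1)
    (hst : s * t = p) (hpq : 1 - t = (1 - p) * (1 - q)) :
    ((_root_.bernoulliMeasure p).prod (_root_.bernoulliMeasure q)).map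
        (fun x ↦ (x.1, max x.1 x.2)) =
      ((_root_.bernoulliMeasure s).prod (_root_.bernoulliMeasure t)).map
        (fun x ↦ (x.1 && x.2, x.2)) := by
  have := isProbabilityMeasure_bernoulliMeasure hp hp1
  have := isProbabilityMeasure_bernoulliMeasure hq hq1
  have := isProbabilityMeasure_bernoulliMeasure hs hs1
  have := isProbabilityMeasure_bernoulliMeasure ht ht1
  have hp' := sub_nonneg.2 hp1
  have hq' := sub_nonneg.2 hq1
  have hs' := sub_nonneg.2 hs1
  have ht' := sub_nonneg.2 ht1
  refine Measure.ext_of_singleton fun b ↦ ?_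
  rw [Measure.map_apply (measurable_of_countable _) (measurableSet_singleton b),
    Measure.map_apply (measurable_of_countable _) (measurableSet_singleton b)]
  rcases b with ⟨_ | _, _ | _⟩
  · rw [show (fun x : Bool × Bool ↦ (x.1, max x.1 x.2)) ⁻¹' {(false, false)} =
        {false} ×ˢ {false} by ext ⟨x, y⟩; cases x <;> cases y <;> simp,
      show (fun x : Bool × Bool ↦ (x.1 && x.2, x.2)) ⁻¹' {(false, false)} =
        Set.univ ×ˢ {false} by ext ⟨x, y⟩; cases x <;> cases y <;> simp]
    simp only [Measure.prod_prod, bernoulliMeasure_false, measure_univ, one_mul, hpq,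
      ENNReal.ofReal_mul hp']
  · rw [show (fun x : Bool × Bool ↦ (x.1, max x.1 x.2)) ⁻¹' {(false, true)} =
        {false} ×ˢ {true} by ext ⟨x, y⟩; cases x <;> cases y <;> simp,
      show (fun x : Bool × Bool ↦ (x.1 && x.2, x.2)) ⁻¹' {(false, true)} =
        {false} ×ˢ {true} by ext ⟨x, y⟩; cases x <;> cases y <;> simp]
    simp only [Measure.prod_prod, bernoulliMeasure_false, bernoulliMeasure_true,
      ← ENNReal.ofReal_mul hp', ← ENNReal.ofReal_mul hs']
    congr 1
    linear_combination hst + hpq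
  · rw [show (fun x : Bool × Bool ↦ (x.1, max x.1 x.2)) ⁻¹' {(true, false)} = ∅ by
        ext ⟨x, y⟩; cases x <;> cases y <;> simp,
      show (fun x : Bool × Bool ↦ (x.1 && x.2, x.2)) ⁻¹' {(true, false)} = ∅ by
        ext ⟨x, y⟩; cases x <;> cases y <;> simp]
    simp
  · rw [show (fun x : Bool × Bool ↦ (x.1, max x.1 x.2)) ⁻¹' {(true, true)} =
        {true} ×ˢ Set.univ by ext ⟨x, y⟩; cases x <;> cases y <;> simp,
      show (fun x : Bool × Bool ↦ (x.1 && x.2, x.2)) ⁻¹' {(true, true)} =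
        {true} ×ˢ {true} by ext ⟨x, y⟩; cases x <;> cases y <;> simp]
    simp only [Measure.prod_prod, bernoulliMeasure_true, measure_univ, mul_one, ← hst,
      ENNReal.ofReal_mul hs]

/-- The joint law of `X` and `max(X, Y)`: given the maximum `Z`, `X` is `Z` thinned by an
independent Bernoulli sequence. -/
lemma map_seqMax_eq_map_seqAnd {p q s t : ℝ} (hp : 0 ≤ p) (hp1 : p ≤ 1) (hq : 0 ≤ q)
    (hq1 : q ≤ 1) (hs : 0 ≤ s) (hs1 : s ≤ 1) (ht : 0 ≤ t) (ht1 : t ≤ 1)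
    (hst : s * t = p) (hpq : 1 - t = (1 - p) * (1 - q)) :
    ((Measure.infinitePi fun _ : ℕ ↦ _root_.bernoulliMeasure p).prod
        (Measure.infinitePi fun _ : ℕ ↦ _root_.bernoulliMeasure q)).map
        (fun ω ↦ (ω.1, seqMax ω)) =
      ((Measure.infinitePi fun _ : ℕ ↦ _root_.bernoulliMeasure s).prod
        (Measure.infinitePi fun _ : ℕ ↦ _root_.bernoulliMeasure t)).map
        (fun ω ↦ (seqAnd ω.1 ω.2, ω.2)) := by
  have := isProbabilityMeasure_bernoulliMeasure hp hp1
  have := isProbabilityMeasure_bernoulliMeasure hq hq1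
  have := isProbabilityMeasure_bernoulliMeasure hs hs1
  have := isProbabilityMeasure_bernoulliMeasure ht ht1
  have key (a b : ℝ) [IsProbabilityMeasure (_root_.bernoulliMeasure a)]
      [IsProbabilityMeasure (_root_.bernoulliMeasure b)] (g : Bool × Bool → Bool × Bool) :
      ((Measure.infinitePi fun _ : ℕ ↦ _root_.bernoulliMeasure a).prod
        (Measure.infinitePi fun _ : ℕ ↦ _root_.bernoulliMeasure b)).map
        (fun ω ↦ (fun i ↦ (g (ω.1 i, ω.2 i)).1, fun i ↦ (g (ω.1 i, ω.2 i)).2)) =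
      (Measure.infinitePi fun _ : ℕ ↦
        ((_root_.bernoulliMeasure a).prod (_root_.bernoulliMeasure b)).map g).map
        (fun x ↦ (fun i ↦ (x i).1, fun i ↦ (x i).2)) := by
    have hg : Measurable g := measurable_of_countable _
    rw [← Measure.infinitePi_map_pi _ fun _ ↦ hg, ← map_zip_infinitePi_prod,
      Measure.map_map (by fun_prop) (by fun_prop), Measure.map_map (by fun_prop) (by fun_prop)]
    rfl
  refine (key p q fun x ↦ (x.1, max x.1 x.2)).trans ?_
  rw [map_bernoulliMeasure_prod_max hp hp1 hq hq1 hs hs1 ht ht1 hst hpq]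
  exact (key s t fun x ↦ (x.1 && x.2, x.2)).symm

/-- If `(X, Z)` has the law of `(g(W, V), V)` with `W` and `V` independent, then a regular
conditional law of `f(X)` given `Z` is almost surely the law of `f(g(W, z))`. -/
lemma condLaw_ae_eq {Ω E F S T : Type*} [MeasurableSpace Ω] [MeasurableSpace E]
    [MeasurableSpace F] [MeasurableSpace S] [MeasurableSpace T]
    [MeasurableSpace.CountableOrCountablyGenerated S T] {P : Measure Ω} [IsProbabilityMeasure P]
    {μ : Measure F} {ρ : Measure S} [IsProbabilityMeasure μ] [IsProbabilityMeasure ρ]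
    {X : Ω → E} {Z : Ω → S} {g : F × S → E} {f : E → T} (hX : Measurable X) (hZ : Measurable Z)
    (hg : Measurable g) (hf : Measurable f)
    (hlaw : P.map (fun ω ↦ (X ω, Z ω)) = (μ.prod ρ).map (fun x ↦ (g x, x.2)))
    (κ : Kernel S T) [IsMarkovKernel κ]
    (hκ : ∀ A B, MeasurableSet A → MeasurableSet B →
      P {ω | Z ω ∈ A ∧ f (X ω) ∈ B} = ∫⁻ ω in {ω | Z ω ∈ A}, κ (Z ω) B ∂P) :
    ∀ᵐ ω ∂P, κ (Z ω) = μ.map fun w ↦ f (g (w, Z ω)) := by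
  have hfg (z : S) : Measurable fun w ↦ f (g (w, z)) := by fun_prop
  have hZlaw : P.map Z = ρ := by
    have h := congrArg (Measure.map Prod.snd) hlaw
    rw [Measure.map_map (by fun_prop) (by fun_prop),
      Measure.map_map (by fun_prop) (by fun_prop)] at h
    have h2 : (μ.prod ρ).map Prod.snd = ρ := by simp
    exact h.trans h2
  let κ₀ : Kernel S T :=
    { toFun := fun z ↦ μ.map fun w ↦ f (g (w, z))
      measurable' := by
        refine Measure.measurable_of_measurable_coe _ fun B hB ↦ ?_
        simp_rw [Measure.map_apply (hfg _) hB]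
        exact measurable_measure_prodMk_right (μ := μ) ((hf.comp hg) hB) }
  have hκ₀ (z : S) : κ₀ z = μ.map fun w ↦ f (g (w, z)) := rfl
  have : IsMarkovKernel κ₀ := ⟨fun z ↦ Measure.isProbabilityMeasure_map (hfg z).aemeasurable⟩
  have hcomp : ρ ⊗ₘ κ = ρ ⊗ₘ κ₀ := by
    refine Measure.ext_prod fun {A B} hA hB ↦ ?_
    rw [Measure.compProd_apply_prod hA hB, Measure.compProd_apply_prod hA hB]
    have hS : MeasurableSet {x : E × S | x.2 ∈ A ∧ f x.1 ∈ B} :=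
      (measurable_snd hA).inter ((hf.comp measurable_fst) hB)
    calc ∫⁻ z in A, κ z B ∂ρ = ∫⁻ ω in {ω | Z ω ∈ A}, κ (Z ω) B ∂P := by
          rw [← hZlaw, setLIntegral_map hA (κ.measurable_coe hB) hZ]
          rfl
      _ = P.map (fun ω ↦ (X ω, Z ω)) {x : E × S | x.2 ∈ A ∧ f x.1 ∈ B} := by
          rw [← hκ A B hA hB, Measure.map_apply (by fun_prop) hS]
          rfl
      _ = ∫⁻ z in A, κ₀ z B ∂ρ := by
          rw [hlaw, Measure.map_apply (by fun_prop) hS,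
            Measure.prod_apply_symm ((hg.prodMk measurable_snd) hS), ← lintegral_indicator hA]
          refine lintegral_congr fun z ↦ ?_
          by_cases hz : z ∈ A
          · simp [hz, hκ₀, Measure.map_apply (hfg z) hB]
            rfl
          · simp [hz]
  have hae := Kernel.ae_eq_of_compProd_eq hcomp
  rw [← hZlaw] at hae
  exact ae_of_ae_map hZ.aemeasurable hae

lemma lintegral_prod_infinitePi {J α : Type*} [MeasurableSpace α] (m : J → Measure α)
    [∀ j, IsProbabilityMeasure (m j)] {h : α → ENNReal} (hh : Measurable h) (s : Finset J) :
    ∫⁻ x, ∏ j ∈ s, h (x j) ∂Measure.infinitePi m = ∏ j ∈ s, ∫⁻ a, h a ∂m j := by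
  rw [lintegral_prod_eq_prod_lintegral_of_indepFun s (fun j (x : J → α) ↦ h (x j))
    (iIndepFun_infinitePi (X := fun _ ↦ h) fun _ ↦ hh) fun j ↦ by fun_prop]
  refine Finset.prod_congr rfl fun j _ ↦ ?_
  rw [← lintegral_map (f := h) (g := fun x : J → α ↦ x j) hh (by fun_prop),
    Measure.infinitePi_map_eval]

lemma ofReal_iSup_le {ι : Type*} [Nonempty ι] {x : ι → ℝ} {b : ENNReal}
    (h : ∀ i, ENNReal.ofReal (x i) ≤ b) : ENNReal.ofReal (⨆ i, x i) ≤ b := by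
  rcases eq_or_ne b ⊤ with rfl | hb
  · exact le_top
  · exact ENNReal.ofReal_le_of_le_toReal
      (ciSup_le fun i ↦ (ENNReal.ofReal_le_iff_le_toReal hb).1 (h i))

lemma abs_boolBias_map_and {s : ℝ} (hs : 0 ≤ s) (hs1 : s ≤ 1) (b : Bool) :
    |boolBias ((_root_.bernoulliMeasure s).map (· && b))| = if b then |1 - 2 * s| else 1 := by
  have := isProbabilityMeasure_bernoulliMeasure hs hs1
  rw [boolBias_map _ (measurable_of_countable _)]
  cases b
  · simp only [Bool.and_false, boolSign, integral_const, probReal_univ]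
    simp
  · simp only [Bool.and_true, if_true, ← boolBias_bernoulliMeasure hs hs1, boolBias]

/-- Total variation bound for the extractor applied to a thinned sequence. -/
lemma abs_map_extractor_sub_le (N : ℕ) {s : ℝ} (hs : 0 ≤ s) (hs1 : s ≤ 1) (z : ℕ → Bool)
    {A : Set (ℕ → Bool)} (hA : MeasurableSet A) :
    ENNReal.ofReal
      |((Measure.infinitePi fun _ : ℕ ↦ _root_.bernoulliMeasure s).map
          (fun w ↦ extractor N (seqAnd w z)) A).toReal -
        (Measure.infinitePi (fun _ : ℕ ↦ _root_.bernoulliMeasure (1 / 2)) A).toReal| ≤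
      ∑' k, ∏ j ∈ Finset.range (N + k),
        ENNReal.ofReal (if z (blockEquiv (k, 0, j)) then |1 - 2 * s| else 1) := by
  have := isProbabilityMeasure_bernoulliMeasure hs hs1
  have hand (b : Bool) : Measurable (· && b) := measurable_of_countable _
  have (i : ℕ) : IsProbabilityMeasure ((_root_.bernoulliMeasure s).map (· && z i)) :=
    Measure.isProbabilityMeasure_map (hand _).aemeasurable
  have hthin : (Measure.infinitePi fun _ : ℕ ↦ _root_.bernoulliMeasure s).map
      (fun w ↦ extractor N (seqAnd w z)) =
      (Measure.infinitePi fun i ↦ (_root_.bernoulliMeasure s).map (· && z i)).map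
        (extractor N) := by
    rw [← Measure.infinitePi_map_pi _ fun i ↦ hand (z i)]
    exact (Measure.map_map (measurable_extractor N) (f := fun w ↦ seqAnd w z)
      (by fun_prop)).symm
  have (k : ℕ) := Measure.isProbabilityMeasure_map (μ := Measure.infinitePi fun a ↦
    (_root_.bernoulliMeasure s).map (· && z (blockEquiv (k, a))))
    (measurable_extractBit (N + k)).aemeasurable
  rw [hthin, map_extractor_infinitePi]
  refine (abs_infinitePi_sub_fair_le _ hA).trans (ENNReal.tsum_le_tsum fun k ↦ ?_)
  refine (ENNReal.ofReal_le_ofReal (abs_boolBias_map_extractBit_le _ _)).trans ?_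
  rw [ENNReal.ofReal_prod_of_nonneg fun _ _ ↦ abs_nonneg _]
  simp only [abs_boolBias_map_and hs hs1, le_refl]

lemma isBernoulliProduct_map_extractor (N : ℕ) {p : ℝ} (hp : 0 < p) (hp1 : p < 1) :
    IsBernoulliProduct (1 / 2)
      ((Measure.infinitePi fun _ : ℕ ↦ _root_.bernoulliMeasure p).map (extractor N)) := by
  have := isProbabilityMeasure_bernoulliMeasure hp.le hp1.le
  have (k : ℕ) := Measure.isProbabilityMeasure_map (μ := Measure.infinitePi
    fun _ : Fin 3 × ℕ ↦ _root_.bernoulliMeasure p) (measurable_extractBit (N + k)).aemeasurable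
  have hbit (k : ℕ) : (Measure.infinitePi fun _ : Fin 3 × ℕ ↦ _root_.bernoulliMeasure p).map
      (extractBit (N + k)) = _root_.bernoulliMeasure (1 / 2) := by
    rw [eq_bernoulliMeasure (Measure.map _ _),
      boolBias_map_extractBit_bernoulliMeasure _ hp hp1, sub_zero]
  rw [map_extractor_infinitePi]
  simp only [hbit]
  exact isBernoulliProduct_infinitePi (by norm_num) (by norm_num)

lemma measurable_prod_thinning (N k : ℕ) (d : ℝ) :
    Measurable fun z : ℕ → Bool ↦ ∏ j ∈ Finset.range (N + k),
      ENNReal.ofReal (if z (blockEquiv (k, 0, j)) then d else 1) :=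
  Finset.measurable_fun_prod _ fun _ _ ↦
    (measurable_of_countable fun b : Bool ↦ ENNReal.ofReal (if b then d else 1)).comp
      (measurable_pi_apply _)

lemma lintegral_tsum_prod_eq (N : ℕ) {t d : ℝ} (ht : 0 ≤ t) (ht1 : t ≤ 1) (hd : 0 ≤ d) :
    ∫⁻ z, ∑' k, ∏ j ∈ Finset.range (N + k),
        ENNReal.ofReal (if z (blockEquiv (k, 0, j)) then d else 1)
        ∂(Measure.infinitePi fun _ : ℕ ↦ _root_.bernoulliMeasure t) =
      ∑' k, ENNReal.ofReal ((1 - t + t * d) ^ (N + k)) := by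
  have := isProbabilityMeasure_bernoulliMeasure ht ht1
  have ht' := sub_nonneg.2 ht1
  have hh : Measurable fun b : Bool ↦ ENNReal.ofReal (if b then d else 1) :=
    measurable_of_countable _
  have hint : ∫⁻ b : Bool, ENNReal.ofReal (if b then d else 1) ∂_root_.bernoulliMeasure t =
      ENNReal.ofReal (1 - t + t * d) := by
    rw [lintegral_fintype, Fintype.sum_bool, bernoulliMeasure_true, bernoulliMeasure_false,
      if_pos rfl, if_neg (by simp), ← ENNReal.ofReal_mul hd, ← ENNReal.ofReal_mul zero_le_one,
      ← ENNReal.ofReal_add (by positivity) (by positivity)]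
    ring_nf
  rw [lintegral_tsum fun k ↦ (measurable_prod_thinning N k d).aemeasurable]
  congr 1 with k
  have hinj : Function.Injective fun j : ℕ ↦ blockEquiv (k, 0, j) := fun i j h ↦ by
    simpa using blockEquiv.injective h
  have h := lintegral_prod_infinitePi (fun _ : ℕ ↦ _root_.bernoulliMeasure t) hh
    ((Finset.range (N + k)).map ⟨_, hinj⟩)
  simp only [Finset.prod_map, hint, Finset.prod_const, Finset.card_map, Finset.card_range] at h
  rw [ENNReal.ofReal_pow (by positivity)]
  exact h

lemma exists_tsum_ofReal_pow_lt {c ε : ℝ} (hc : 0 ≤ c) (hc1 : c < 1) (hε : 0 < ε) :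
    ∃ N : ℕ, ∑' k, ENNReal.ofReal (c ^ (N + k)) < ENNReal.ofReal ε := by
  obtain ⟨N, hN⟩ := exists_pow_lt_of_lt_one (mul_pos hε (sub_pos.2 hc1)) hc1
  refine ⟨N, ?_⟩
  have hsum : HasSum (fun k ↦ c ^ (N + k)) (c ^ N * (1 - c)⁻¹) := by
    simpa only [pow_add] using (hasSum_geometric_of_lt_one hc hc1).mul_left (c ^ N)
  rw [← ENNReal.ofReal_tsum_of_nonneg (fun k ↦ pow_nonneg hc _) hsum.summable, hsum.tsum_eq]
  exact (ENNReal.ofReal_lt_ofReal_iff hε).2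
    ((mul_inv_lt_iff₀ (sub_pos.2 hc1)).2 hN)

/-- For every `ε > 0` there is an `ε`-extractor into `{0,1}^ℕ`: a measurable
`f : {0,1}^ℕ → {0,1}^ℕ` with `f(X) ~ Bernoulli(1/2)^ℕ` and
`E[ d_TV( L(f(X) | max(X,Y)), Bernoulli(1/2)^ℕ ) ] < ε`, for any regular conditional
distribution `κ` of `f(X)` given `max(X,Y)`. -/
theorem eps_extractor_into_sequences (p q : ℝ) (hp : 0 < p) (hp1 : p < 1)
    (hq : 0 < q) (hq1 : q < 1) (ε : ℝ) (hε : 0 < ε)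
    (μp μq : Measure (ℕ → Bool))
    (hμp : IsBernoulliProduct p μp) (hμq : IsBernoulliProduct q μq)
    (ν : Measure (ℕ → Bool)) (hν : IsBernoulliProduct (1/2) ν) :
    ∃ f : (ℕ → Bool) → (ℕ → Bool), Measurable f ∧
      IsBernoulliProduct (1/2) ((μp.prod μq).map (fun ω => f ω.1)) ∧
      ∀ κ : ProbabilityTheory.Kernel (ℕ → Bool) (ℕ → Bool), IsMarkovKernel κ →
        -- `κ` is a regular conditional distribution of `f(X)` given `max(X,Y)`:
        (∀ A B : Set (ℕ → Bool), MeasurableSet A → MeasurableSet B →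
          (μp.prod μq) {ω | (fun i => max (ω.1 i) (ω.2 i)) ∈ A ∧ f ω.1 ∈ B} =
            ∫⁻ ω in {ω | (fun i => max (ω.1 i) (ω.2 i)) ∈ A},
              κ (fun i => max (ω.1 i) (ω.2 i)) B ∂(μp.prod μq)) →
        -- the expected total-variation distance to `Bernoulli(1/2)^ℕ` is less than `ε`:
        ∫⁻ ω, ENNReal.ofReal (⨆ A : {s : Set (ℕ → Bool) // MeasurableSet s},
            |((κ (fun i => max (ω.1 i) (ω.2 i))) A.1).toReal - (ν A.1).toReal|)
          ∂(μp.prod μq) < ENNReal.ofReal ε := by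
  obtain rfl := hμp.eq_infinitePi hp.le hp1.le
  obtain rfl := hμq.eq_infinitePi hq.le hq1.le
  obtain rfl := hν.eq_infinitePi (by norm_num) (by norm_num)
  have := isProbabilityMeasure_bernoulliMeasure hp.le hp1.le
  have := isProbabilityMeasure_bernoulliMeasure hq.le hq1.le
  set t := 1 - (1 - p) * (1 - q) with ht
  have hpq : 0 < (1 - p) * q := mul_pos (sub_pos.2 hp1) hq
  have hpt : p < t := by linarith
  have ht0 : 0 < t := hp.trans hpt
  have ht1 : t < 1 := by
    have := mul_pos (sub_pos.2 hp1) (sub_pos.2 hq1)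
    linarith
  set s := p / t
  have hs0 : 0 < s := div_pos hp ht0
  have hs1 : s < 1 := (div_lt_one ht0).2 hpt
  have hbias : |1 - 2 * s| < 1 := abs_lt.2 ⟨by linarith, by linarith⟩
  have := isProbabilityMeasure_bernoulliMeasure hs0.le hs1.le
  have := isProbabilityMeasure_bernoulliMeasure ht0.le ht1.le
  have hc0 : 0 ≤ 1 - t + t * |1 - 2 * s| :=
    add_nonneg (sub_nonneg.2 ht1.le) (mul_nonneg ht0.le (abs_nonneg _))
  have hc1 : 1 - t + t * |1 - 2 * s| < 1 := by
    have := mul_lt_mul_of_pos_left hbias ht0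
    linarith
  obtain ⟨N, hN⟩ := exists_tsum_ofReal_pow_lt hc0 hc1 hε
  have hlaw := map_seqMax_eq_map_seqAnd hp.le hp1.le hq.le hq1.le hs0.le hs1.le ht0.le ht1.le
    (div_mul_cancel₀ p ht0.ne') (by rw [ht]; ring)
  refine ⟨extractor N, measurable_extractor N, ?_, fun κ _ hκ ↦ ?_⟩
  · have := isBernoulliProduct_map_extractor N hp hp1
    have h := Measure.map_map (μ := (Measure.infinitePi fun _ : ℕ ↦ _root_.bernoulliMeasure p).prod
        (Measure.infinitePi fun _ : ℕ ↦ _root_.bernoulliMeasure q))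
      (measurable_extractor N) measurable_fst
    rw [Measure.map_fst_prod, measure_univ, one_smul] at h
    rwa [h] at this
  have hcond := condLaw_ae_eq measurable_fst measurable_seqMax measurable_seqAnd
    (measurable_extractor N) hlaw κ hκ
  have hmax : ((Measure.infinitePi fun _ : ℕ ↦ _root_.bernoulliMeasure p).prod
        (Measure.infinitePi fun _ : ℕ ↦ _root_.bernoulliMeasure q)).map seqMax =
      Measure.infinitePi fun _ ↦ _root_.bernoulliMeasure t := by
    have h := congrArg (Measure.map Prod.snd) hlaw
    rw [Measure.map_map (by fun_prop) (by fun_prop),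
      Measure.map_map (by fun_prop) (by fun_prop)] at h
    refine h.trans ?_
    change Measure.map Prod.snd _ = _
    simp
  refine lt_of_le_of_lt ?_ hN
  rw [← lintegral_tsum_prod_eq N ht0.le ht1.le (abs_nonneg (1 - 2 * s)), ← hmax,
    lintegral_map (.tsum fun k ↦ measurable_prod_thinning N k _) measurable_seqMax]
  refine lintegral_mono_ae ?_
  filter_upwards [hcond] with ω hω
  have : Nonempty {s : Set (ℕ → Bool) // MeasurableSet s} := ⟨⟨∅, .empty⟩⟩
  refine ofReal_iSup_le fun A ↦ ?_
  have h : κ (fun i ↦ max (ω.1 i) (ω.2 i)) = _ := hω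
  rw [h]
  exact abs_map_extractor_sub_le N hs0.le hs1.le (seqMax ω) A.2
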